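/- Assume in addition that d_q ∘ d_q = 0 and D = 0, and set H_q := {h − E(h) : h ∈ B⊗̂H}. Then with respect to the internal direct sum B⊗̂V = H_q ⊕ d_q(B⊗̂R) ⊕ (B⊗̂R), the map d_q vanishes on H_q and on d_q(B⊗̂R), and maps B⊗̂R into d_q(B⊗̂R); consequently ker(d_q) = H_q ⊕ d_q(B⊗̂R) and range(d_q) = d_q(B⊗̂R). -/

import Mathlib

/-!
`B` is a "deformation base": a commutative Noetherian local ℂ-algebra, complete in the
`𝔪`-adic topology, with residue field `ℂ`.  For a ℂ-vector space `X`, the completed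
tensor product `B ⊗̂ X` is the `𝔪`-adic completion of `B ⊗[ℂ] X`, realized as the
inverse limit of the modules `(B ⊗[ℂ] X) ⧸ 𝔪^k (B ⊗[ℂ] X) ≅ B/𝔪^k ⊗[ℂ] X`.
-/

open scoped TensorProduct
open IsLocalRing

/-- The completed tensor product `B ⊗̂ X`. -/
noncomputable abbrev CTP (B : Type) [CommRing B] [Algebra ℂ B] [IsLocalRing B]
    (X : Type) [AddCommGroup X] [Module ℂ X] : Type :=
  AdicCompletion (maximalIdeal B) (B ⊗[ℂ] X)

/-- The canonical embedding `X → B ⊗̂ X`, `x ↦ 1 ⊗ x`. -/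
noncomputable def iota (B : Type) [CommRing B] [Algebra ℂ B] [IsLocalRing B]
    (X : Type) [AddCommGroup X] [Module ℂ X] (x : X) : CTP B X :=
  AdicCompletion.of (maximalIdeal B) (B ⊗[ℂ] X) ((1 : B) ⊗ₜ x)

/-- The submodule `𝔪^k X ⊆ B ⊗̂ X`: the kernel of the canonical projection
`B ⊗̂ X → (B ⊗[ℂ] X) ⧸ 𝔪^k (B ⊗[ℂ] X) ≅ B/𝔪^k ⊗[ℂ] X`. -/
noncomputable def mpow (B : Type) [CommRing B] [Algebra ℂ B] [IsLocalRing B]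
    (X : Type) [AddCommGroup X] [Module ℂ X] (k : ℕ) : Submodule B (CTP B X) :=
  LinearMap.ker (AdicCompletion.eval (maximalIdeal B) (B ⊗[ℂ] X) k)

/-- The `𝔪`-adic topology on `B ⊗̂ X`, generated by the cosets `x + 𝔪^k X`. -/
noncomputable def adicTop (B : Type) [CommRing B] [Algebra ℂ B] [IsLocalRing B]
    (X : Type) [AddCommGroup X] [Module ℂ X] : TopologicalSpace (CTP B X) :=
  TopologicalSpace.generateFrom
    {s | ∃ (x : CTP B X) (k : ℕ), s = {y | y - x ∈ mpow B X k}}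

/-- For a ℂ-subspace `W ⊆ V`, the `B`-submodule `B ⊗̂ W ⊆ B ⊗̂ V`: those elements all of
whose finite-level components `(B ⊗[ℂ] V) ⧸ 𝔪^n (B ⊗[ℂ] V)` come from `B ⊗[ℂ] W`. -/
noncomputable def csub (B : Type) [CommRing B] [Algebra ℂ B] [IsLocalRing B]
    (V : Type) [AddCommGroup V] [Module ℂ V] (W : Submodule ℂ V) :
    Submodule B (CTP B V) :=
  ⨅ n : ℕ, Submodule.comap
    (AdicCompletion.eval (maximalIdeal B) (B ⊗[ℂ] V) n)
    (LinearMap.range ((Submodule.mkQ ((maximalIdeal B) ^ n • ⊤)).comp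
      ((W.subtype).baseChange B)))

section CompletedMaps

variable {B : Type} [CommRing B] [Algebra ℂ B] [IsLocalRing B]
  {V : Type} [AddCommGroup V] [Module ℂ V]

/-- The `B`-linear extension of a `ℂ`-linear map to completed tensor products. -/
noncomputable def completedMap (B : Type) [CommRing B] [Algebra ℂ B] [IsLocalRing B]
    {V : Type} [AddCommGroup V] [Module ℂ V] (f : V →ₗ[ℂ] V) : CTP B V →ₗ[B] CTP B V :=
  (AdicCompletion.map (maximalIdeal B) (f.baseChange B)).restrictScalars B

theorem CTP.exists_eval_eq (x : CTP B V) (n : ℕ) :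
    ∃ w : B ⊗[ℂ] V, AdicCompletion.eval (maximalIdeal B) (B ⊗[ℂ] V) n x =
      Submodule.mkQ _ w :=
  let ⟨w, hw⟩ := Submodule.mkQ_surjective _ (AdicCompletion.eval (maximalIdeal B) _ n x)
  ⟨w, hw.symm⟩

theorem eval_completedMap (f : V →ₗ[ℂ] V) {x : CTP B V} {n : ℕ} {w : B ⊗[ℂ] V}
    (h : AdicCompletion.eval (maximalIdeal B) (B ⊗[ℂ] V) n x = Submodule.mkQ _ w) :
    AdicCompletion.eval (maximalIdeal B) (B ⊗[ℂ] V) n (completedMap B f x) =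
      Submodule.mkQ _ (f.baseChange B w) := by
  change (f.baseChange B).reduceModIdeal _ (AdicCompletion.eval (maximalIdeal B) _ n x) = _
  rw [h]
  rfl

theorem CTP.ext_eval {x y : CTP B V}
    (h : ∀ n, AdicCompletion.eval (maximalIdeal B) (B ⊗[ℂ] V) n x =
      AdicCompletion.eval (maximalIdeal B) (B ⊗[ℂ] V) n y) : x = y :=
  AdicCompletion.ext h

theorem completedMap_iota (f : V →ₗ[ℂ] V) (v : V) :
    completedMap B f (iota B V v) = iota B V (f v) := by
  refine CTP.ext_eval fun n => ?_
  rw [iota, iota, eval_completedMap f (AdicCompletion.eval_of _ _ n _), AdicCompletion.eval_of,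
    LinearMap.baseChange_tmul]

theorem completedMap_id_apply (x : CTP B V) : completedMap B LinearMap.id x = x := by
  refine CTP.ext_eval fun n => ?_
  obtain ⟨w, hw⟩ := CTP.exists_eval_eq x n
  rw [eval_completedMap _ hw, hw, LinearMap.baseChange_id, LinearMap.id_apply]

theorem completedMap_zero_apply (x : CTP B V) : completedMap B (0 : V →ₗ[ℂ] V) x = 0 := by
  refine CTP.ext_eval fun n => ?_
  obtain ⟨w, hw⟩ := CTP.exists_eval_eq x n
  rw [eval_completedMap _ hw, LinearMap.baseChange_zero, LinearMap.zero_apply, map_zero, map_zero]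

theorem completedMap_add_apply (f g : V →ₗ[ℂ] V) (x : CTP B V) :
    completedMap B (f + g) x = completedMap B f x + completedMap B g x := by
  refine CTP.ext_eval fun n => ?_
  obtain ⟨w, hw⟩ := CTP.exists_eval_eq x n
  rw [map_add, eval_completedMap _ hw, eval_completedMap _ hw, eval_completedMap _ hw,
    LinearMap.baseChange_add, LinearMap.add_apply, map_add]

theorem completedMap_comp_apply (f g : V →ₗ[ℂ] V) (x : CTP B V) :
    completedMap B (f ∘ₗ g) x = completedMap B f (completedMap B g x) := by
  refine CTP.ext_eval fun n => ?_
  obtain ⟨w, hw⟩ := CTP.exists_eval_eq x n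
  rw [eval_completedMap _ hw, eval_completedMap _ (eval_completedMap _ hw),
    LinearMap.baseChange_comp, LinearMap.comp_apply]

theorem completedMap_mem_csub {f : V →ₗ[ℂ] V} {W : Submodule ℂ V} (hf : ∀ v, f v ∈ W)
    (x : CTP B V) : completedMap B f x ∈ csub B V W := by
  refine (Submodule.mem_iInf _).2 fun n => ?_
  obtain ⟨w, hw⟩ := CTP.exists_eval_eq x n
  refine ⟨(f.codRestrict W hf).baseChange B w, ?_⟩
  have hfW : W.subtype ∘ₗ f.codRestrict W hf = f := LinearMap.subtype_comp_codRestrict ..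
  rw [eval_completedMap _ hw, LinearMap.comp_apply,
    ← LinearMap.comp_apply (W.subtype.baseChange B), ← LinearMap.baseChange_comp, hfW]

theorem completedMap_apply_of_mem_csub {f : V →ₗ[ℂ] V} {W : Submodule ℂ V}
    (hf : ∀ v ∈ W, f v = v) {x : CTP B V} (hx : x ∈ csub B V W) : completedMap B f x = x := by
  refine CTP.ext_eval fun n => ?_
  obtain ⟨w, hw⟩ := (Submodule.mem_iInf _).1 hx n
  have hfW : f ∘ₗ W.subtype = W.subtype := LinearMap.ext fun v => hf v v.2
  rw [eval_completedMap _ hw.symm, ← hw, ← LinearMap.comp_apply (f.baseChange B),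
    ← LinearMap.baseChange_comp, hfW, LinearMap.comp_apply]

variable [IsNoetherianRing B]

theorem mpow_eq_smul_top (k : ℕ) : mpow B V k = maximalIdeal B ^ k • ⊤ :=
  (AdicCompletion.pow_smul_top_eq_ker_eval (maximalIdeal B).fg_of_isNoetherianRing).symm

theorem map_mem_mpow (φ : CTP B V →ₗ[B] CTP B V) {k : ℕ} {x : CTP B V} (hx : x ∈ mpow B V k) :
    φ x ∈ mpow B V k := by
  rw [mpow_eq_smul_top] at hx ⊢
  have h := Submodule.mem_map_of_mem (f := φ) hx
  rw [Submodule.map_smul''] at h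
  exact Submodule.smul_mono le_rfl le_top h

/-- A `B`-linear map agrees modulo `𝔪` with the extension of its leading term. -/
theorem sub_completedMap_mem_mpow {φ : CTP B V →ₗ[B] CTP B V} {f : V →ₗ[ℂ] V}
    (h : ∀ v : V, φ (iota B V v) - iota B V (f v) ∈ mpow B V 1) (x : CTP B V) :
    φ x - completedMap B f x ∈ mpow B V 1 := by
  obtain ⟨w, hw⟩ := CTP.exists_eval_eq x 1
  have hxw : x - AdicCompletion.of (maximalIdeal B) _ w ∈ mpow B V 1 := by
    rw [mpow, LinearMap.mem_ker, map_sub, hw, AdicCompletion.eval_of, sub_self]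
  have hof : (φ - completedMap B f) (AdicCompletion.of (maximalIdeal B) _ w) ∈ mpow B V 1 := by
    induction w using TensorProduct.induction_on generalizing x with
    | zero => simp
    | tmul b v =>
      have hb : AdicCompletion.of (maximalIdeal B) (B ⊗[ℂ] V) (b ⊗ₜ v) = b • iota B V v := by
        rw [iota, ← map_smul, TensorProduct.smul_tmul', smul_eq_mul, mul_one]
      rw [hb, map_smul, LinearMap.sub_apply, completedMap_iota]
      exact Submodule.smul_mem _ _ (h v)
    | add a c ha hc =>
      rw [map_add, map_add]
      exact add_mem
        (ha (AdicCompletion.of (maximalIdeal B) _ a) rfl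
          (by rw [sub_self]; exact zero_mem _))
        (hc (AdicCompletion.of (maximalIdeal B) _ c) rfl
          (by rw [sub_self]; exact zero_mem _))
  have := add_mem (map_mem_mpow (φ - completedMap B f) hxw) hof
  rwa [← map_add, sub_add_cancel] at this

/-- A `B`-linear endomorphism that is the identity modulo `𝔪` is bijective. -/
theorem bijective_of_sub_self_mem_mpow {φ : CTP B V →ₗ[B] CTP B V}
    (h : ∀ x, φ x - x ∈ mpow B V 1) : Function.Bijective φ := by
  have hfg := (maximalIdeal B).fg_of_isNoetherianRing
  have : IsAdicComplete (maximalIdeal B) (CTP B V) := AdicCompletion.isAdicComplete hfg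
  have hφ : ∀ x, φ x - x ∈ maximalIdeal B • (⊤ : Submodule B (CTP B V)) := fun x => by
    simpa [mpow_eq_smul_top] using h x
  constructor
  · rw [injective_iff_map_eq_zero]
    intro x hx
    refine IsHausdorff.haus (I := maximalIdeal B) inferInstance x fun n => SModEq.zero.2 ?_
    induction n with
    | zero => simp
    | succ n ih =>
      have hsub : (φ - LinearMap.id : CTP B V →ₗ[B] CTP B V) x = -x := by simp [hx]
      have hr : LinearMap.range (φ - LinearMap.id : CTP B V →ₗ[B] CTP B V) ≤ maximalIdeal B • ⊤ := by
        rintro _ ⟨y, rfl⟩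
        exact hφ y
      have hm := Submodule.mem_map_of_mem (f := (φ - LinearMap.id : CTP B V →ₗ[B] CTP B V)) ih
      rw [hsub, Submodule.map_smul'', Submodule.map_top] at hm
      rw [← neg_mem_iff, pow_succ, Submodule.mul_smul]
      exact Submodule.smul_mono le_rfl hr hm
  · refine surjective_of_mkQ_comp_surjective (I := maximalIdeal B) fun y => ?_
    obtain ⟨x, rfl⟩ := Submodule.mkQ_surjective _ y
    exact ⟨x, (Submodule.Quotient.eq _).2 (hφ x)⟩

end CompletedMaps

/-- The projections onto `H` and `R` of a homological splitting, together with the partial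
inverse `g` of `d`. -/
theorem exists_splitting_maps {V : Type} [AddCommGroup V] [Module ℂ V]
    {H I R : Submodule ℂ V} {d : V →ₗ[ℂ] V} (hsup : H ⊔ I ⊔ R = ⊤)
    (hdisjH : Disjoint H (I ⊔ R)) (hdisjIR : Disjoint I R)
    (hI : I = LinearMap.range d) (hker : LinearMap.ker d = H ⊔ I) :
    ∃ p r g : V →ₗ[ℂ] V, (∀ v, p v ∈ H) ∧ (∀ v, r v ∈ R) ∧ (∀ v, g v ∈ R) ∧
      (∀ v ∈ R, r v = v) ∧ (∀ v ∈ R, (g ∘ₗ d) v = v) ∧ p ∘ₗ d = 0 ∧ r ∘ₗ d = 0 ∧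
      p + d ∘ₗ g + r = LinearMap.id := by
  have hcH : IsCompl H (I ⊔ R) := ⟨hdisjH, codisjoint_iff.2 (by rw [← sup_assoc, hsup])⟩
  have hdR : Disjoint (H ⊔ I) R := hdisjIR.disjoint_sup_left_of_disjoint_sup_right hdisjH
  have hcR : IsCompl R (H ⊔ I) := ⟨hdR.symm, codisjoint_iff.2 (by rw [sup_comm, hsup])⟩
  set p := H.projection (I ⊔ R) hcH
  set r := R.projection (H ⊔ I) hcR
  have hrR : ∀ v ∈ R, r v = v := fun v hv => Submodule.projection_apply_of_mem_left hcR hv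
  have hdI : ∀ v, d v ∈ I := fun v => hI ▸ LinearMap.mem_range_self d v
  have hpd : ∀ v, p (d v) = 0 := fun v =>
    (Submodule.projection_apply_eq_zero_iff hcH).2 (Submodule.mem_sup_left (hdI v))
  have hrd : ∀ v, r (d v) = 0 := fun v =>
    (Submodule.projection_apply_eq_zero_iff hcR).2 (Submodule.mem_sup_right (hdI v))
  have hdr : ∀ v, d (r v) = d v := fun v => by
    have hv : v - r v ∈ LinearMap.ker d := hker ▸ Submodule.sub_projection_mem hcR v
    rw [LinearMap.mem_ker, map_sub, sub_eq_zero] at hv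
    exact hv.symm
  have hqI : ∀ v, v - p v - r v ∈ I := fun v => by
    have h1 : v - p v ∈ I ⊔ R := Submodule.sub_projection_mem hcH v
    obtain ⟨i, hi, u, hu, hiu⟩ := Submodule.mem_sup.1 h1
    have hrv : r v = u := by
      have h2 : r (p v) = 0 := (Submodule.projection_apply_eq_zero_iff hcR).2
        (Submodule.mem_sup_left (Submodule.projection_apply_mem hcH v))
      have h3 : r i = 0 := (Submodule.projection_apply_eq_zero_iff hcR).2
        (Submodule.mem_sup_right hi)
      have h4 := congrArg r hiu
      rwa [map_add, map_sub, h2, h3, zero_add, sub_zero, hrR u hu, eq_comm] at h4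
    rwa [← hiu, hrv, add_sub_cancel_right]
  have hinj : LinearMap.ker (d ∘ₗ R.subtype) = ⊥ := by
    rw [LinearMap.ker_eq_bot']
    intro u hu
    exact Subtype.ext (Submodule.disjoint_def.1 hdR u (hker ▸ LinearMap.mem_ker.2 hu) u.2)
  obtain ⟨l, hl⟩ := LinearMap.exists_leftInverse_of_injective _ hinj
  have hl' : ∀ u (hu : u ∈ R), (l (d u) : V) = u := fun u hu =>
    congrArg Subtype.val (LinearMap.congr_fun hl ⟨u, hu⟩)
  refine ⟨p, r, R.subtype ∘ₗ l ∘ₗ (LinearMap.id - p - r), Submodule.projection_apply_mem hcH,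
    Submodule.projection_apply_mem hcR, fun v => Subtype.prop _, hrR, fun v hv => ?_,
    LinearMap.ext hpd, LinearMap.ext hrd, LinearMap.ext fun v => ?_⟩
  · simp [hpd, hrd, hl' v hv]
  · have hq := hqI v
    rw [hI] at hq
    obtain ⟨w, hw⟩ := hq
    have hdl : d (l (v - p v - r v)) = v - p v - r v := by
      rw [← hw, ← hdr w, hl' _ (Submodule.projection_apply_mem hcR w)]
    simp only [LinearMap.add_apply, LinearMap.comp_apply, LinearMap.sub_apply,
      LinearMap.id_apply, Submodule.subtype_apply, hdl]
    abel

/-- Assume `d_q ∘ d_q = 0` and `D = 0`, and set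
`H_q := {h - E h : h ∈ B ⊗̂ H}`.  With respect to the internal direct sum
`B ⊗̂ V = H_q ⊕ d_q(B ⊗̂ R) ⊕ (B ⊗̂ R)`, the map `d_q` vanishes on `H_q` and on
`d_q(B ⊗̂ R)`, and maps `B ⊗̂ R` into `d_q(B ⊗̂ R)`; consequently
`ker d_q = H_q ⊕ d_q(B ⊗̂ R)` and `range d_q = d_q(B ⊗̂ R)`. -/
theorem dq_shape_of_D_eq_zero
    (B : Type) [CommRing B] [Algebra ℂ B] [IsNoetherianRing B] [IsLocalRing B]
    [IsAdicComplete (maximalIdeal B) B]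
    (hres : Function.Bijective (algebraMap ℂ (ResidueField B)))
    (V : Type) [AddCommGroup V] [Module ℂ V]
    (H I R : Submodule ℂ V) (d : V →ₗ[ℂ] V)
    (hsup : H ⊔ I ⊔ R = ⊤)
    (hdisjH : Disjoint H (I ⊔ R)) (hdisjIR : Disjoint I R)
    (hI : I = LinearMap.range d)
    (hker : LinearMap.ker d = H ⊔ I)
    (dq : CTP B V →ₗ[B] CTP B V)
    (hlead : ∀ v : V, dq (iota B V v) - iota B V (d v) ∈ mpow B V 1)
    (D E F : CTP B V →ₗ[B] CTP B V)
    (hD : ∀ h ∈ csub B V H, D h ∈ csub B V H)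
    (hE : ∀ h ∈ csub B V H, E h ∈ csub B V R)
    (hF : ∀ h ∈ csub B V H, F h ∈ csub B V R)
    (hDEF : ∀ h ∈ csub B V H, dq h = D h + dq (E h) + F h)
    (hdq2 : ∀ x : CTP B V, dq (dq x) = 0)
    (hD0 : ∀ h ∈ csub B V H, D h = 0) :
    (∀ x ∈ Submodule.map (LinearMap.id - E) (csub B V H), dq x = 0) ∧
    (∀ x ∈ Submodule.map dq (csub B V R), dq x = 0) ∧
    (∀ x ∈ csub B V R, dq x ∈ Submodule.map dq (csub B V R)) ∧
    LinearMap.ker dq =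
      Submodule.map (LinearMap.id - E) (csub B V H) ⊔ Submodule.map dq (csub B V R) ∧
    LinearMap.range dq = Submodule.map dq (csub B V R) := by
  obtain ⟨p, r, g, hp, hr, hg, hrR, hgd, hpd, hrd, hid⟩ :=
    exists_splitting_maps hsup hdisjH hdisjIR hI hker
  set Φ : CTP B V →ₗ[B] CTP B V :=
    completedMap B p + dq ∘ₗ completedMap B g + completedMap B r with hΦ
  have hΦbij : Function.Bijective Φ := by
    refine bijective_of_sub_self_mem_mpow fun x => ?_
    have hx : x = completedMap B p x + completedMap B d (completedMap B g x) +
        completedMap B r x := by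
      rw [← completedMap_comp_apply, ← completedMap_add_apply, ← completedMap_add_apply, hid,
        completedMap_id_apply]
    have hΦx : Φ x - x =
        dq (completedMap B g x) - completedMap B d (completedMap B g x) := by
      conv_lhs => rw [hΦ]; arg 2; rw [hx]
      simp only [LinearMap.add_apply, LinearMap.comp_apply]
      abel
    rw [hΦx]
    exact sub_completedMap_mem_mpow hlead _
  have hinj : ∀ x ∈ csub B V R, dq x = 0 → x = 0 := fun x hx hdx => by
    have hgdx : completedMap B g (completedMap B d x) = x := by
      rw [← completedMap_comp_apply, completedMap_apply_of_mem_csub hgd hx]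
    have hzero : Φ (completedMap B d x) = 0 := by
      simp only [hΦ, LinearMap.add_apply, LinearMap.comp_apply]
      rw [hgdx, hdx, ← completedMap_comp_apply, ← completedMap_comp_apply, hpd, hrd,
        completedMap_zero_apply, add_zero, add_zero]
    rw [← hgdx, hΦbij.1 (hzero.trans (map_zero Φ).symm), map_zero]
  have hdqE : ∀ h ∈ csub B V H, dq h = dq (E h) := fun h hh => by
    have hdh := hDEF h hh
    have hdF : dq (F h) = 0 := by
      have := congrArg dq hdh
      rwa [map_add, map_add, hD0 h hh, map_zero, hdq2, hdq2, zero_add, zero_add, eq_comm] at this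
    rw [hdh, hD0 h hh, hinj _ (hF h hh) hdF, zero_add, add_zero]
  have hdecomp : ∀ x, ∃ h ∈ csub B V H, ∃ s ∈ csub B V R, ∃ t ∈ csub B V R,
      x = h + dq s + t := fun x => by
    obtain ⟨y, rfl⟩ := hΦbij.2 x
    exact ⟨_, completedMap_mem_csub hp y, _, completedMap_mem_csub hg y, _,
      completedMap_mem_csub hr y, rfl⟩
  have hHq : ∀ x ∈ Submodule.map (LinearMap.id - E) (csub B V H), dq x = 0 := by
    rintro _ ⟨h, hh, rfl⟩
    rw [LinearMap.sub_apply, LinearMap.id_apply, map_sub, hdqE h hh, sub_self]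
  have hdR : ∀ x ∈ Submodule.map dq (csub B V R), dq x = 0 := by
    rintro _ ⟨x, -, rfl⟩
    exact hdq2 x
  refine ⟨hHq, hdR, fun x hx => Submodule.mem_map_of_mem hx,
    le_antisymm (fun x hx => ?_) (sup_le hHq hdR), le_antisymm ?_ (LinearMap.map_le_range)⟩
  · obtain ⟨h, hh, s, hs, t, ht, rfl⟩ := hdecomp x
    have hEt : E h + t = 0 := hinj _ (add_mem (hE h hh) ht) <| by
      rwa [LinearMap.mem_ker, map_add, map_add, hdq2, add_zero, hdqE h hh, ← map_add] at hx
    refine Submodule.mem_sup.2 ⟨_, Submodule.mem_map_of_mem hh, _,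
      Submodule.mem_map_of_mem hs, ?_⟩
    rw [LinearMap.sub_apply, LinearMap.id_apply, eq_neg_of_add_eq_zero_left hEt]
    abel
  · rintro _ ⟨x, rfl⟩
    obtain ⟨h, hh, s, hs, t, ht, rfl⟩ := hdecomp x
    refine ⟨E h + t, add_mem (hE h hh) ht, ?_⟩
    rw [map_add, map_add, map_add, hdq2, add_zero, hdqE h hh]
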